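/- Let A be quasi-associative with respect to B, with L = Z(B). Then dim_F A = dim_L(B) · (dim_F L)^2. -/

import Mathlib

open scoped TensorProduct

/-- The nucleus of a (possibly nonassociative) algebra. -/
def nucleus (A : Type*) [Mul A] : Set A :=
  {x | (∀ y z : A, x * y * z = x * (y * z)) ∧ (∀ y z : A, y * x * z = y * (x * z)) ∧
       (∀ y z : A, y * z * x = y * (z * x))}

/-- The action of `K ⊗ K` on `A` by left and right multiplication through `j : K →ₗ A`:
`(k ⊗ k') • a = (j k) a (j k')`. -/
noncomputable def biAct {F K A : Type*} [Field F] [Ring K] [Algebra F K]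
    [NonUnitalNonAssocRing A] [Module F A] [SMulCommClass F A A] [IsScalarTower F A A]
    (j : K →ₗ[F] A) : K ⊗[F] K →ₗ[F] A →ₗ[F] A :=
  TensorProduct.lift <| LinearMap.mk₂ F
    (fun k k' => (LinearMap.mulRight F (j k')).comp (LinearMap.mulLeft F (j k)))
    (fun k₁ k₂ k' => by ext a; simp [add_mul])
    (fun s k k' => by ext a; simp [smul_mul_assoc])
    (fun k k₁' k₂' => by ext a; simp [mul_add])
    (fun s k k' => by ext a; simp [mul_smul_comm])

/-- Over a commutative semilocal ring, a finite projective module whose endomorphism ring is free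
of rank `n ^ 2` is itself free of rank `n`. -/
theorem nonempty_basis_of_basis_end {R M ι : Type*} [CommRing R] [Finite (MaximalSpectrum R)]
    [AddCommGroup M] [Module R M] [Module.Finite R M] [Module.Projective R M] [Fintype ι]
    (b : Module.Basis ι R (Module.End R M)) {n : ℕ} (hn : Fintype.card ι = n ^ 2) :
    Nonempty (Module.Basis (Fin n) R M) := by
  have : Module.FinitePresentation R M := Module.finitePresentation_of_projective R M
  have hrank (p : PrimeSpectrum R) : Module.rankAtStalk (R := R) M p = n := by
    have : Module.Free R (Module.End R M) := .of_basis b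
    have : Module.Finite R (Module.End R M) := .of_basis b
    have hend : Module.rankAtStalk (R := R) (Module.End R M) p =
        Module.rankAtStalk (R := R) M p ^ 2 := by
      let e := IsLocalizedModule.iso p.asIdeal.primeCompl
        (LocalizedModule.map p.asIdeal.primeCompl (M := M) (N := M))
      have he := (LinearEquiv.extendScalarsOfIsLocalization p.asIdeal.primeCompl
        (Localization p.asIdeal.primeCompl) e).finrank_eq
      have : Module.Free (Localization p.asIdeal.primeCompl)
          (LocalizedModule p.asIdeal.primeCompl M) :=
        Module.free_of_flat_of_isLocalRing (R := Localization.AtPrime p.asIdeal)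
      rw [Module.rankAtStalk, Module.rankAtStalk, sq]
      refine he.trans (Module.finrank_linearMap _ _ _ _)
    have : Nontrivial R := p.nontrivial
    have hfree : Module.rankAtStalk (R := R) (Module.End R M) p = n ^ 2 := by
      rw [Module.rankAtStalk_eq_finrank_of_free, ← hn]
      exact Module.finrank_eq_card_basis b
    exact Nat.pow_left_injective two_ne_zero (hend.symm.trans hfree)
  refine Module.nonempty_basis_of_flat_of_finrank_eq R M n fun P ↦ ?_
  let := Ideal.Quotient.field P.asIdeal
  have h := Module.rankAtStalk_baseChange (R := R) (M := M) (S := R ⧸ P.asIdeal) ⊥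
  rw [hrank, Module.rankAtStalk_eq_finrank_of_free] at h
  exact h

/-- If `S` is a semisimple commutative `F`-algebra and `End_S V` is spanned over `S` by `n ^ 2`
elements and has dimension `n ^ 2 * dim_F S`, then `dim_F V = n * dim_F S`. -/
theorem finrank_eq_of_span_end {F S V ι : Type*} [Field F] [CommRing S] [Algebra F S]
    [FiniteDimensional F S] [IsSemisimpleRing S] [AddCommGroup V] [Module F V] [Module S V]
    [IsScalarTower F S V] [FiniteDimensional F V] [Fintype ι]
    (e : ι → Module.End S V) (he : ⊤ ≤ Submodule.span S (Set.range e)) {n : ℕ}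
    (hn : Fintype.card ι = n ^ 2)
    (hfin : Module.finrank F (Module.End S V) = n ^ 2 * Module.finrank F S) :
    Module.finrank F V = n * Module.finrank F S := by
  have : Module.Finite S V := Module.Finite.of_restrictScalars_finite F S V
  have : IsArtinianRing S := IsArtinianRing.of_finite F S
  have : Module.Projective S V := Module.projective_of_isSemisimpleRing S V
  have hsurj : Function.Surjective (Fintype.linearCombination S e) := by
    rw [← LinearMap.range_eq_top, Fintype.range_linearCombination]
    exact top_le_iff.mp he
  have : FiniteDimensional F (Module.End S V) :=
    Module.Finite.of_surjective ((Fintype.linearCombination S e).restrictScalars F) hsurj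
  have hinj : Function.Injective ((Fintype.linearCombination S e).restrictScalars F) := by
    refine (LinearMap.injective_iff_surjective_of_finrank_eq_finrank ?_).mpr hsurj
    rw [hfin, Module.finrank_pi_fintype]
    simp [hn]
  have hli : LinearIndependent S e :=
    linearIndependent_iff_injective_fintypeLinearCombination.mpr hinj
  obtain ⟨b⟩ := nonempty_basis_of_basis_end (Module.Basis.mk hli he) hn
  rw [(b.equivFun.restrictScalars F).finrank_eq, Module.finrank_pi_fintype]
  simp

/-- The tensor square of a finite separable field extension is a semisimple ring. -/
theorem isSemisimpleRing_tensorProduct_self (F K : Type*) [Field F] [Field K] [Algebra F K]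
    [FiniteDimensional F K] [Algebra.IsSeparable F K] : IsSemisimpleRing (K ⊗[F] K) := by
  have : Algebra.FormallyUnramified F K := Algebra.FormallyUnramified.of_isSeparable F K
  have : IsReduced (K ⊗[F] K) := Algebra.FormallyUnramified.isReduced_of_field K _
  have : IsArtinianRing (K ⊗[F] K) := IsArtinianRing.of_finite F _
  exact IsArtinianRing.isSemisimpleRing_of_isReduced _

/-- Let `K` be a finite separable field extension of `F` mapping to the center of `B`. If `B ⊗ B`
acts faithfully on `A` through `j : B → A`, with image all the endomorphisms of `A` that commute
with the two actions of `K`, then `dim_F A = dim_K B · (dim_F K)²`. -/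
theorem finrank_eq_of_biAct {F K A B : Type*} [Field F] [Field K] [Algebra F K]
    [FiniteDimensional F K] [Algebra.IsSeparable F K]
    [NonAssocRing A] [Module F A] [SMulCommClass F A A] [IsScalarTower F A A]
    [FiniteDimensional F A] [Ring B] [Algebra F B] [FiniteDimensional F B]
    [Module K B] [IsScalarTower F K B] (ι : K →ₐ[F] B)
    (hι : ∀ (k : K) (b : B), k • b = ι k * b) (hcomm : ∀ (k : K) (b : B), ι k * b = b * ι k)
    (j : B →ₗ[F] A) (hj_mul : ∀ b b' : B, j (b * b') = j b * j b') (hj_one : j 1 = 1)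
    (hj_nuc : ∀ b : B, j b ∈ nucleus A)
    (hinj : ∀ x : B ⊗[F] B, (∀ a : A, biAct j x a = 0) → x = 0)
    (hsurj : ∀ f : A →ₗ[F] A,
      (∀ (k : K) (a : A), f (j (ι k) * a) = j (ι k) * f a ∧ f (a * j (ι k)) = f a * j (ι k)) →
      ∃ x : B ⊗[F] B, ∀ a : A, biAct j x a = f a) :
    Module.finrank F A = Module.finrank K B * Module.finrank F K ^ 2 := by
  have := isSemisimpleRing_tensorProduct_self F K
  have hl (b : B) (x y : A) : j b * x * y = j b * (x * y) := (hj_nuc b).1 x y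
  have hm (b : B) (x y : A) : x * j b * y = x * (j b * y) := (hj_nuc b).2.1 x y
  have hbi (b b' : B) (a : A) : biAct j (b ⊗ₜ b') a = j b * a * j b' := rfl
  let ρ : K ⊗[F] K →ₐ[F] Module.End F A :=
    Algebra.TensorProduct.algHomOfLinearMapTensorProduct
      (biAct j ∘ₗ TensorProduct.map ι.toLinearMap ι.toLinearMap)
      (fun l₁ l₂ k₁ k₂ ↦ by
        ext a
        have : j (ι k₁ * ι k₂) = j (ι k₂ * ι k₁) := by rw [hcomm]
        rw [hj_mul, hj_mul] at this
        simp [hbi, this, hj_mul, hl, hm])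
      (by ext a; simp [hbi, hj_one])
  let : Module (K ⊗[F] K) A := Module.compHom A ρ.toRingHom
  have hsmul (s : K ⊗[F] K) (a : A) : s • a = ρ s a := rfl
  have hsmul_tmul (l k : K) (a : A) : (l ⊗ₜ[F] k) • a = j (ι l) * a * j (ι k) := rfl
  have : IsScalarTower F (K ⊗[F] K) A := ⟨fun c s a ↦ by simp [hsmul]⟩
  let Φ₀ (x : B ⊗[F] B) : Module.End (K ⊗[F] K) A :=
    { biAct j x with
      map_smul' := fun s a ↦ by
        change biAct j x (s • a) = s • biAct j x a
        induction s with
        | zero => simp only [zero_smul, map_zero]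
        | add s t hs ht => simp only [add_smul, map_add, hs, ht]
        | tmul l k =>
          induction x with
          | zero => simp
          | add x y hx hy => simp only [map_add, LinearMap.add_apply, smul_add, hx, hy]
          | tmul b b' =>
            have h₁ : j b * j (ι l) = j (ι l) * j b := by rw [← hj_mul, ← hj_mul, hcomm]
            have h₂ : j (ι k) * j b' = j b' * j (ι k) := by rw [← hj_mul, ← hj_mul, hcomm]
            simp only [hsmul_tmul, hbi, hl, hm]
            rw [h₂, ← hl b, h₁, hl] }
  let Φ : B ⊗[F] B →ₗ[F] Module.End (K ⊗[F] K) A :=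
    { toFun := Φ₀
      map_add' := fun x y ↦ by ext a; simp [Φ₀]
      map_smul' := fun c x ↦ by ext a; simp [Φ₀] }
  have hΦ (x : B ⊗[F] B) (a : A) : Φ x a = biAct j x a := rfl
  have hΦ_inj : Function.Injective Φ :=
    (injective_iff_map_eq_zero Φ).mpr fun x hx ↦ hinj x fun a ↦ by rw [← hΦ, hx]; rfl
  have hΦ_surj : Function.Surjective Φ := fun f ↦ by
    obtain ⟨x, hx⟩ := hsurj (f.restrictScalars F) fun k a ↦ by
      have h₁ := f.map_smul (k ⊗ₜ[F] (1 : K)) a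
      have h₂ := f.map_smul ((1 : K) ⊗ₜ[F] k) a
      simp only [hsmul_tmul] at h₁ h₂
      simpa [hj_one] using And.intro h₁ h₂
    exact ⟨x, LinearMap.ext hx⟩
  have hΦ_smul (l k : K) (b b' : B) :
      Φ ((l • b) ⊗ₜ (k • b')) = (l ⊗ₜ[F] k) • Φ (b ⊗ₜ b') := by
    ext a
    have h₁ : l • b = ι l * b := hι l b
    have h₂ : k • b' = b' * ι k := (hι k b').trans (hcomm k b')
    rw [LinearMap.smul_apply, hΦ, hΦ, hbi, hbi, hsmul_tmul, h₁, h₂, hj_mul, hj_mul]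
    simp only [hl, hm]
  have : Module.Finite K B := Module.Finite.of_restrictScalars_finite F K B
  let b := Module.finBasis K B
  have hdimB : Module.finrank F B = Module.finrank F K * Module.finrank K B :=
    (Module.finrank_mul_finrank F K B).symm
  have key := finrank_eq_of_span_end (F := F) (S := K ⊗[F] K) (V := A)
    (n := Module.finrank K B)
    (fun p : Fin (Module.finrank K B) × Fin (Module.finrank K B) ↦ Φ (b p.1 ⊗ₜ b p.2))
    (fun f _ ↦ by
      obtain ⟨x, rfl⟩ := hΦ_surj f
      induction x with
      | zero => simp
      | add x y hx hy => rw [map_add]; exact add_mem (hx trivial) (hy trivial)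
      | tmul c d =>
        rw [← b.sum_repr c, ← b.sum_repr d, TensorProduct.sum_tmul, map_sum]
        refine sum_mem fun i _ ↦ ?_
        rw [TensorProduct.tmul_sum, map_sum]
        refine sum_mem fun i' _ ↦ ?_
        rw [hΦ_smul]
        exact Submodule.smul_mem _ _ (Submodule.subset_span ⟨(i, i'), rfl⟩))
    (by simp [sq])
    (by
      rw [← (LinearEquiv.ofBijective Φ ⟨hΦ_inj, hΦ_surj⟩).finrank_eq,
        Module.finrank_tensorProduct, Module.finrank_tensorProduct, hdimB]
      ring)
  rw [key, Module.finrank_tensorProduct, sq]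

/-- If `A` is quasi-associative with respect to `B`, with `L = Z(B)`, then
`dim_F A = dim_L B · (dim_F L)²`. -/
theorem stmt_7 {F A B : Type*} [Field F]
    [NonAssocRing A] [Module F A] [SMulCommClass F A A] [IsScalarTower F A A]
    [FiniteDimensional F A]
    [Ring B] [Algebra F B] [FiniteDimensional F B] [IsSimpleRing B]
    [Algebra.IsSeparable F (Subalgebra.center F B)]
    (j : B →ₗ[F] A) (hj_inj : Function.Injective j)
    (hj_mul : ∀ b b' : B, j (b * b') = j b * j b') (hj_one : j 1 = 1)
    (hj_nuc : ∀ b : B, j b ∈ nucleus A)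
    (hinj : ∀ x : B ⊗[F] B, (∀ a : A, biAct j x a = 0) → x = 0)
    (hsurj : ∀ f : A →ₗ[F] A,
      (∀ b ∈ Subalgebra.center F B, ∀ a : A, f (j b * a) = j b * f a ∧
        f (a * j b) = f a * j b) →
      ∃ x : B ⊗[F] B, ∀ a : A, biAct j x a = f a) :
    Module.finrank F A =
      Module.finrank (Subalgebra.center F B) B *
        (Module.finrank F (Subalgebra.center F B)) ^ 2 := by
  have hfield : IsField (Subalgebra.center F B) := IsSimpleRing.isField_center B
  let : Field (Subalgebra.center F B) := hfield.toField
  exact finrank_eq_of_biAct (K := Subalgebra.center F B) (Subalgebra.center F B).val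
    (fun _ _ ↦ rfl) (fun k b ↦ (Subalgebra.mem_center_iff.mp k.2 b).symm) j hj_mul hj_one hj_nuc hinj
    fun f hf ↦ hsurj f fun b hb ↦ hf ⟨b, hb⟩
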